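/- arXiv:0802.1077 — 2 statements merged into one kernel-verified Lean document; each statement's English description precedes it below -/
import Mathlib

section
/- Let f : ℂ → ℂ^N be holomorphic, twice continuously differentiable as a map of two real variables, with f(ξ) ≠ 0 for all ξ, and define P(ξ) := 1 - (f(ξ) ⊗ f(ξ)†)/(f(ξ)† · f(ξ)). Then P satisfies the Euler–Lagrange equation of the CP^{N-1} sigma model in projector form: ∂[∂̄P, P](ξ) + ∂̄[∂P, P](ξ) = 0 for all ξ. -/
open Matrix Complex

attribute [local instance] Matrix.normedAddCommGroup Matrix.normedSpace

/-- Wirtinger derivative ∂u. -/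
noncomputable def wirtingerD {E : Type*} [NormedAddCommGroup E] [NormedSpace ℂ E]
    (u : ℂ → E) (z : ℂ) : E :=
  (2 : ℂ)⁻¹ • (fderiv ℝ u z 1 - Complex.I • fderiv ℝ u z Complex.I)

/-- Wirtinger derivative ∂̄u. -/
noncomputable def wirtingerDBar {E : Type*} [NormedAddCommGroup E] [NormedSpace ℂ E]
    (u : ℂ → E) (z : ℂ) : E :=
  (2 : ℂ)⁻¹ • (fderiv ℝ u z 1 + Complex.I • fderiv ℝ u z Complex.I)

/-- The rank-(N-1) projector P = 1 - (f ⊗ f†)/(f† · f). -/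
noncomputable def projP {N : ℕ} (f : ℂ → Fin N → ℂ) (ξ : ℂ) :
    Matrix (Fin N) (Fin N) ℂ :=
  1 - Matrix.of (fun j k => f ξ j * (starRingEnd ℂ) (f ξ k) /
    (∑ l, (starRingEnd ℂ) (f ξ l) * f ξ l))

section Wirtinger

variable {E F G : Type*} [NormedAddCommGroup E] [NormedSpace ℂ E]
  [NormedAddCommGroup F] [NormedSpace ℂ F] [NormedAddCommGroup G] [NormedSpace ℂ G]

theorem fderiv_bilinear_apply (B : E →L[ℂ] F →L[ℂ] G) {u : ℂ → E} {v : ℂ → F} {z : ℂ}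
    (hu : DifferentiableAt ℝ u z) (hv : DifferentiableAt ℝ v z) (a : ℂ) :
    fderiv ℝ (fun w => B (u w) (v w)) z a =
      B (u z) (fderiv ℝ v z a) + B (fderiv ℝ u z a) (v z) := by
  rw [show (fun w => B (u w) (v w)) = fun w => B.bilinearRestrictScalars ℝ (u w) (v w) from rfl,
    ContinuousLinearMap.fderiv_of_bilinear _ hu hv]
  simp

/-- The product rule for `∂` and a complex-bilinear product. -/
theorem wirtingerD_bilinear (B : E →L[ℂ] F →L[ℂ] G) {u : ℂ → E} {v : ℂ → F} {z : ℂ}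
    (hu : DifferentiableAt ℝ u z) (hv : DifferentiableAt ℝ v z) :
    wirtingerD (fun w => B (u w) (v w)) z =
      B (u z) (wirtingerD v z) + B (wirtingerD u z) (v z) := by
  simp only [wirtingerD, fderiv_bilinear_apply B hu hv, map_smul, map_sub,
    _root_.smul_apply, _root_.sub_apply]
  module

/-- The product rule for `∂̄` and a complex-bilinear product. -/
theorem wirtingerDBar_bilinear (B : E →L[ℂ] F →L[ℂ] G) {u : ℂ → E} {v : ℂ → F} {z : ℂ}
    (hu : DifferentiableAt ℝ u z) (hv : DifferentiableAt ℝ v z) :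
    wirtingerDBar (fun w => B (u w) (v w)) z =
      B (u z) (wirtingerDBar v z) + B (wirtingerDBar u z) (v z) := by
  simp only [wirtingerDBar, fderiv_bilinear_apply B hu hv, map_smul, map_add,
    _root_.smul_apply, _root_.add_apply]
  module

theorem wirtingerD_zero (z : ℂ) : wirtingerD (fun _ => (0 : E)) z = 0 := by
  simp [wirtingerD]

theorem wirtingerDBar_zero (z : ℂ) : wirtingerDBar (fun _ => (0 : E)) z = 0 := by
  simp [wirtingerDBar]

theorem wirtingerDBar_neg (u : ℂ → E) (z : ℂ) :
    wirtingerDBar (fun w => -u w) z = -wirtingerDBar u z := by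
  simp only [wirtingerDBar, fderiv_fun_neg, _root_.neg_apply]
  module

/-- The Cauchy–Riemann equation: a holomorphic map is annihilated by `∂̄`. -/
theorem wirtingerDBar_eq_zero {u : ℂ → E} {z : ℂ} (hu : DifferentiableAt ℂ u z) :
    wirtingerDBar u z = 0 := by
  have h : fderiv ℝ u z Complex.I = Complex.I • fderiv ℝ u z 1 := by
    rw [hu.fderiv_restrictScalars ℝ, ContinuousLinearMap.coe_restrictScalars', ← map_smul]
    simp
  rw [wirtingerDBar, h, smul_smul, Complex.I_mul_I]
  simp

/-- The conjugate of a holomorphic map is annihilated by `∂`. -/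
theorem wirtingerD_star_eq_zero {ι : Type*} [Fintype ι] {u : ℂ → ι → ℂ} {z : ℂ}
    (hu : DifferentiableAt ℂ u z) : wirtingerD (fun w => star (u w)) z = 0 := by
  have h : fderiv ℝ u z Complex.I = Complex.I • fderiv ℝ u z 1 := by
    rw [hu.fderiv_restrictScalars ℝ, ContinuousLinearMap.coe_restrictScalars', ← map_smul]
    simp
  have hs : ∀ a, fderiv ℝ (fun w => star (u w)) z a = star (fderiv ℝ u z a) := by
    intro a
    rw [fderiv_star]
    rfl
  rw [wirtingerD, hs, hs, h, star_smul, smul_smul]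
  simp

/-- The Wirtinger derivatives of a `C²` map commute. -/
theorem wirtingerD_wirtingerDBar_comm {u : ℂ → E} (hu : ContDiff ℝ 2 u) (z : ℂ) :
    wirtingerD (wirtingerDBar u) z = wirtingerDBar (wirtingerD u) z := by
  have hd : Differentiable ℝ (fderiv ℝ u) :=
    (hu.fderiv_right (m := 1) (by norm_num)).differentiable (by norm_num)
  have hda : ∀ a : ℂ, DifferentiableAt ℝ (fun w => fderiv ℝ u w a) z := fun a =>
    (hd z).clm_apply (differentiableAt_const a)
  have happ : ∀ a b : ℂ, fderiv ℝ (fun w => fderiv ℝ u w a) z b =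
      fderiv ℝ (fderiv ℝ u) z b a := by
    intro a b
    rw [fderiv_clm_apply (hd z) (differentiableAt_const a)]
    simp
  have hsymm : fderiv ℝ (fderiv ℝ u) z 1 Complex.I = fderiv ℝ (fderiv ℝ u) z Complex.I 1 :=
    hu.contDiffAt.isSymmSndFDerivAt (by simp) 1 Complex.I
  have hbar : ∀ b : ℂ, fderiv ℝ (wirtingerDBar u) z b = (2 : ℂ)⁻¹ •
      (fderiv ℝ (fderiv ℝ u) z b 1 + Complex.I • fderiv ℝ (fderiv ℝ u) z b Complex.I) := by
    intro b
    have h := (((hda 1).hasFDerivAt.add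
      ((hda Complex.I).hasFDerivAt.const_smul Complex.I)).const_smul (2 : ℂ)⁻¹).fderiv
    refine (congrArg (fun L : ℂ →L[ℝ] E => L b) h).trans ?_
    simp [happ]
  have hD : ∀ b : ℂ, fderiv ℝ (wirtingerD u) z b = (2 : ℂ)⁻¹ •
      (fderiv ℝ (fderiv ℝ u) z b 1 - Complex.I • fderiv ℝ (fderiv ℝ u) z b Complex.I) := by
    intro b
    have h := (((hda 1).hasFDerivAt.sub
      ((hda Complex.I).hasFDerivAt.const_smul Complex.I)).const_smul (2 : ℂ)⁻¹).fderiv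
    refine (congrArg (fun L : ℂ →L[ℝ] E => L b) h).trans ?_
    simp [happ]
  rw [wirtingerD, wirtingerDBar, hbar, hbar, hD, hD, hsymm]
  module

end Wirtinger

section Projector

variable {N : ℕ} {f : ℂ → Fin N → ℂ}

open scoped ComplexOrder in
theorem sum_conj_mul_self_ne_zero {v : Fin N → ℂ} (hv : v ≠ 0) :
    ∑ l, (starRingEnd ℂ) (v l) * v l ≠ 0 :=
  fun h => hv (dotProduct_star_self_eq_zero.1 h)

theorem projP_eq_one_sub_smul_vecMulVec (f : ℂ → Fin N → ℂ) (z : ℂ) :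
    projP f z = 1 - (∑ l, (starRingEnd ℂ) (f z l) * f z l)⁻¹ • vecMulVec (f z) (star (f z)) := by
  ext j k
  simp [projP, vecMulVec_apply, div_eq_inv_mul]

theorem projP_mulVec_self {z : ℂ} (hz : f z ≠ 0) : projP f z *ᵥ f z = 0 := by
  have hs : star (f z) ⬝ᵥ f z ≠ 0 := sum_conj_mul_self_ne_zero hz
  rw [projP_eq_one_sub_smul_vecMulVec, sub_mulVec, one_mulVec, smul_mulVec, vecMulVec_mulVec,
    show (∑ l, (starRingEnd ℂ) (f z l) * f z l) = star (f z) ⬝ᵥ f z from rfl]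
  ext j
  simp [hs]

theorem star_vecMul_projP {z : ℂ} (hz : f z ≠ 0) : star (f z) ᵥ* projP f z = 0 := by
  have hs : star (f z) ⬝ᵥ f z ≠ 0 := sum_conj_mul_self_ne_zero hz
  rw [projP_eq_one_sub_smul_vecMulVec, vecMul_sub, vecMul_one, vecMul_smul, vecMul_vecMulVec,
    show (∑ l, (starRingEnd ℂ) (f z l) * f z l) = star (f z) ⬝ᵥ f z from rfl]
  ext j
  simp [hs]

theorem mul_projP_of_mulVec_eq_zero {z : ℂ} {X : Matrix (Fin N) (Fin N) ℂ}
    (hX : X *ᵥ f z = 0) : X * projP f z = X := by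
  rw [projP_eq_one_sub_smul_vecMulVec, mul_sub, mul_one, Matrix.mul_smul, mul_vecMulVec, hX]
  simp

theorem projP_mul_of_vecMul_eq_zero {z : ℂ} {X : Matrix (Fin N) (Fin N) ℂ}
    (hX : star (f z) ᵥ* X = 0) : projP f z * X = X := by
  rw [projP_eq_one_sub_smul_vecMulVec, sub_mul, one_mul, Matrix.smul_mul, vecMulVec_mul, hX]
  simp

theorem projP_mul_self {z : ℂ} (hz : f z ≠ 0) : projP f z * projP f z = projP f z :=
  mul_projP_of_mulVec_eq_zero (projP_mulVec_self hz)

theorem contDiff_projP (hsmooth : ContDiff ℝ 2 f) (hne : ∀ z, f z ≠ 0) :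
    ContDiff ℝ 2 (projP f) := by
  have hc : ∀ j, ContDiff ℝ 2 fun z => f z j := fun j => contDiff_pi.1 hsmooth j
  have hcc : ∀ j, ContDiff ℝ 2 fun z => (starRingEnd ℂ) (f z j) := fun j =>
    Complex.conjCLE.contDiff.comp (hc j)
  refine contDiff_pi.2 fun j => contDiff_pi.2 fun k => ?_
  simp only [projP, Matrix.sub_apply, Matrix.of_apply, div_eq_mul_inv]
  exact contDiff_const.sub (((hc j).mul (hcc k)).mul
    ((ContDiff.sum fun l _ => (hcc l).mul (hc l)).inv fun z => sum_conj_mul_self_ne_zero (hne z)))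

/-- `[∂̄P, P] = ∂̄P`. -/
theorem commutator_wirtingerDBar_projP (hf : Differentiable ℂ f)
    (hsmooth : ContDiff ℝ 2 f) (hne : ∀ z, f z ≠ 0) (z : ℂ) :
    wirtingerDBar (projP f) z * projP f z - projP f z * wirtingerDBar (projP f) z =
      wirtingerDBar (projP f) z := by
  have hP : DifferentiableAt ℝ (projP f) z :=
    (contDiff_projP hsmooth hne).differentiable (by norm_num) z
  have hann : wirtingerDBar (projP f) z *ᵥ f z = 0 := by
    have h := wirtingerDBar_bilinear
      (mulVecBilin ℂ ℂ : Matrix (Fin N) (Fin N) ℂ →ₗ[ℂ] _ →ₗ[ℂ] _).toContinuousBilinearMap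
      hP ((hf z).restrictScalars ℝ)
    change wirtingerDBar (fun w => projP f w *ᵥ f w) z =
      projP f z *ᵥ wirtingerDBar f z + wirtingerDBar (projP f) z *ᵥ f z at h
    simpa [projP_mulVec_self, hne, wirtingerDBar_zero, wirtingerDBar_eq_zero (hf z)] using h.symm
  have hX := mul_projP_of_mulVec_eq_zero hann
  have hidem := wirtingerDBar_bilinear
    (mulLinearMap ℂ : Matrix (Fin N) (Fin N) ℂ →ₗ[ℂ] Matrix (Fin N) (Fin N) ℂ →ₗ[ℂ]
      Matrix (Fin N) (Fin N) ℂ).toContinuousBilinearMap hP hP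
  change wirtingerDBar (fun w => projP f w * projP f w) z =
    projP f z * wirtingerDBar (projP f) z + wirtingerDBar (projP f) z * projP f z at hidem
  simp only [projP_mul_self (hne _), hX] at hidem
  rw [hX, right_eq_add.1 hidem, sub_zero]

/-- `[∂P, P] = -∂P`. -/
theorem commutator_wirtingerD_projP (hf : Differentiable ℂ f)
    (hsmooth : ContDiff ℝ 2 f) (hne : ∀ z, f z ≠ 0) (z : ℂ) :
    wirtingerD (projP f) z * projP f z - projP f z * wirtingerD (projP f) z =
      -wirtingerD (projP f) z := by
  have hP : DifferentiableAt ℝ (projP f) z :=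
    (contDiff_projP hsmooth hne).differentiable (by norm_num) z
  have hann : star (f z) ᵥ* wirtingerD (projP f) z = 0 := by
    have h := wirtingerD_bilinear
      (vecMulBilin ℂ ℂ : _ →ₗ[ℂ] Matrix (Fin N) (Fin N) ℂ →ₗ[ℂ] _).toContinuousBilinearMap
      (((hf z).restrictScalars ℝ).star) hP
    change wirtingerD (fun w => star (f w) ᵥ* projP f w) z =
      star (f z) ᵥ* wirtingerD (projP f) z +
        wirtingerD (fun w => star (f w)) z ᵥ* projP f z at h
    simpa [star_vecMul_projP, hne, wirtingerD_zero, wirtingerD_star_eq_zero (hf z)] using h.symm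
  have hX := projP_mul_of_vecMul_eq_zero hann
  have hidem := wirtingerD_bilinear
    (mulLinearMap ℂ : Matrix (Fin N) (Fin N) ℂ →ₗ[ℂ] Matrix (Fin N) (Fin N) ℂ →ₗ[ℂ]
      Matrix (Fin N) (Fin N) ℂ).toContinuousBilinearMap hP hP
  change wirtingerD (fun w => projP f w * projP f w) z =
    projP f z * wirtingerD (projP f) z + wirtingerD (projP f) z * projP f z at hidem
  simp only [projP_mul_self (hne _), hX] at hidem
  rw [hX, left_eq_add.1 hidem, zero_sub]

end Projector

theorem euler_lagrange_projector_form (N : ℕ) (f : ℂ → Fin N → ℂ)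
    (hf : Differentiable ℂ f) (hsmooth : ContDiff ℝ 2 f)
    (hne : ∀ ξ, f ξ ≠ 0) (ξ : ℂ) :
    wirtingerD (fun w => wirtingerDBar (projP f) w * projP f w -
        projP f w * wirtingerDBar (projP f) w) ξ +
      wirtingerDBar (fun w => wirtingerD (projP f) w * projP f w -
        projP f w * wirtingerD (projP f) w) ξ = 0 := by
  simp only [commutator_wirtingerDBar_projP hf hsmooth hne,
    commutator_wirtingerD_projP hf hsmooth hne]
  rw [wirtingerDBar_neg, ← wirtingerD_wirtingerDBar_comm (contDiff_projP hsmooth hne)]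
  exact add_neg_cancel _
end

section
/- Let f₁ : ℂ → ℂ³ be the map f₁(ξ) = (-√2·conj ξ, 1 - |ξ|², √2·ξ) and P₁(ξ) := 1 - (f₁(ξ) ⊗ f₁(ξ)†)/(f₁(ξ)† · f₁(ξ)). Then the induced metric coefficient of the associated surface satisfies, for every ξ ∈ ℂ: (∂f₁(ξ))† ⋅ (P₁(ξ).mulVec (∂f₁(ξ))) / (f₁(ξ)† · f₁(ξ)) = 2/(1 + |ξ|²)², where ∂f₁ is the Wirtinger derivative of f₁. -/
open Matrix Complex

/-- The mixed Veronese solution f₁(ξ) = (-√2 ξ̄, 1 - |ξ|², √2 ξ). -/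
noncomputable def fmix (ξ : ℂ) : Fin 3 → ℂ :=
  ![-(Real.sqrt 2 : ℂ) * (starRingEnd ℂ) ξ,
    1 - (Complex.normSq ξ : ℂ), (Real.sqrt 2 : ℂ) * ξ]

/-- The projector P₁ = 1 - (f₁ ⊗ f₁†)/(f₁† · f₁). -/
noncomputable def projP1 (ξ : ℂ) : Matrix (Fin 3) (Fin 3) ℂ :=
  1 - Matrix.of (fun j k => fmix ξ j * (starRingEnd ℂ) (fmix ξ k) /
    (∑ l, (starRingEnd ℂ) (fmix ξ l) * fmix ξ l))

/-- The real Fréchet derivative of `fmix`. -/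
lemma hasFDerivAt_fmix (ξ : ℂ) :
    HasFDerivAt fmix (ContinuousLinearMap.pi
      ![(-(Real.sqrt 2 : ℂ)) • (conjCLE : ℂ →L[ℝ] ℂ),
        -(ξ • (conjCLE : ℂ →L[ℝ] ℂ) +
          (starRingEnd ℂ) ξ • ContinuousLinearMap.id ℝ ℂ),
        (Real.sqrt 2 : ℂ) • ContinuousLinearMap.id ℝ ℂ]) ξ := by
  have hconj : HasFDerivAt (fun z : ℂ => (starRingEnd ℂ) z) (conjCLE : ℂ →L[ℝ] ℂ) ξ :=
    conjCLE.hasFDerivAt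
  have hid : HasFDerivAt (fun z : ℂ => z) (ContinuousLinearMap.id ℝ ℂ) ξ := hasFDerivAt_id ξ
  rw [hasFDerivAt_pi']
  intro i
  fin_cases i
  · exact hconj.const_mul (-(Real.sqrt 2 : ℂ))
  · have h := (hid.mul hconj).const_sub (1 : ℂ)
    refine h.congr_of_eventuallyEq (.of_forall fun z => ?_)
    simp [fmix, Complex.mul_conj]
  · exact hid.const_mul (Real.sqrt 2 : ℂ)

lemma wirtingerD_fmix (ξ : ℂ) :
    wirtingerD fmix ξ = ![0, -(starRingEnd ℂ) ξ, (Real.sqrt 2 : ℂ)] := by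
  rw [wirtingerD, (hasFDerivAt_fmix ξ).fderiv]
  ext i
  fin_cases i
  · simp
    linear_combination (-(Real.sqrt 2 : ℂ)) * I_mul_I
  · simp
    linear_combination (((starRingEnd ℂ) ξ - ξ) / 2) * I_mul_I
  · simp
    linear_combination (-(Real.sqrt 2 : ℂ) / 2) * I_mul_I

lemma ofReal_sqrt_two_sq : (Real.sqrt 2 : ℂ) ^ 2 = 2 := by
  rw [← ofReal_pow, Real.sq_sqrt zero_le_two, ofReal_ofNat]

lemma sum_conj_fmix_mul_fmix (ξ : ℂ) :
    ∑ l, (starRingEnd ℂ) (fmix ξ l) * fmix ξ l = (1 + (normSq ξ : ℂ)) ^ 2 := by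
  simp only [fmix, Fin.sum_univ_three, Matrix.cons_val, map_mul, map_neg, map_sub, map_one,
    conj_ofReal, conj_conj]
  linear_combination (2 * (ξ * (starRingEnd ℂ) ξ)) * ofReal_sqrt_two_sq + 4 * mul_conj ξ

theorem mixed_solution_metric_coefficient (ξ : ℂ) :
    (∑ l, (starRingEnd ℂ) (wirtingerD fmix ξ l) *
        ((projP1 ξ).mulVec (wirtingerD fmix ξ) l)) /
      (∑ l, (starRingEnd ℂ) (fmix ξ l) * fmix ξ l) =
      2 / (1 + (Complex.normSq ξ : ℂ)) ^ 2 := by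
  have hne : (1 + (normSq ξ : ℂ)) ≠ 0 := by
    exact_mod_cast (add_pos_of_pos_of_nonneg one_pos (normSq_nonneg ξ)).ne'
  have hs := ofReal_sqrt_two_sq
  have hn := mul_conj ξ
  rw [projP1, sum_conj_fmix_mul_fmix, wirtingerD_fmix]
  congr 1
  simp only [Matrix.sub_mulVec, Matrix.one_mulVec, Pi.sub_apply]
  simp only [Matrix.mulVec, dotProduct, Matrix.of_apply, fmix, Fin.sum_univ_three, Matrix.cons_val, map_mul, map_neg, map_sub,
    map_one, map_zero, conj_ofReal, conj_conj]
  generalize (Real.sqrt 2 : ℂ) = s at *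
  generalize (normSq ξ : ℂ) = r at *
  generalize (starRingEnd ℂ) ξ = c at *
  field_simp
  subst hn
  grind
end
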